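/- arXiv:1510.05089 — 2 statements merged into one kernel-verified Lean document; each statement's English description precedes it below -/
import Mathlib

section
/- For γ ∈ (1,2), every partial sum of the Grünwald coefficients through index at least 1 is strictly negative: ∑_{j=0}^{k+1} g_j^{(γ)} < 0 for all k ≥ 0. -/
/-- Grünwald coefficient `g_j^(s) = ((-1)^j / j!) * s(s-1)⋯(s-j+1)` (with `g_0 = 1`). -/
noncomputable def grunwald (s : ℝ) (j : ℕ) : ℝ :=
  (-1) ^ j / (Nat.factorial j : ℝ) * ∏ i ∈ Finset.range j, (s - i)

theorem grunwald_succ (s : ℝ) (n : ℕ) :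
    grunwald s (n + 1) = grunwald s n * ((n - s) / (n + 1)) := by
  have h1 : (Nat.factorial n : ℝ) ≠ 0 := by exact_mod_cast Nat.factorial_ne_zero n
  have h2 : (n : ℝ) + 1 ≠ 0 := by positivity
  simp only [grunwald, Finset.prod_range_succ, Nat.factorial_succ, Nat.cast_mul, Nat.cast_succ,
    pow_succ]
  field_simp
  ring

theorem mul_sum_grunwald (s : ℝ) (n : ℕ) :
    s * ∑ j ∈ Finset.range (n + 1), grunwald s j = -((n + 1) * grunwald s (n + 1)) := by
  induction n with
  | zero => simp [grunwald]
  | succ n ih =>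
    rw [Finset.sum_range_succ, mul_add, ih, grunwald_succ s (n + 1)]
    have h : (n : ℝ) + 1 + 1 ≠ 0 := by positivity
    push_cast
    field_simp
    ring

theorem grunwald_add_two_pos {s : ℝ} (hs : s ∈ Set.Ioo (1 : ℝ) 2) (n : ℕ) :
    0 < grunwald s (n + 2) := by
  obtain ⟨h1, h2⟩ := hs
  induction n with
  | zero =>
    have h : grunwald s (0 + 2) = s * (s - 1) / 2 := by
      simp [grunwald, Finset.prod_range_succ]
      ring
    rw [h]
    have : 0 < s - 1 := by linarith
    positivity
  | succ n ih =>
    rw [show n + 1 + 2 = n + 2 + 1 by ring, grunwald_succ]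
    have hn : (0 : ℝ) ≤ n := n.cast_nonneg
    refine mul_pos ih (div_pos ?_ (by positivity))
    push_cast
    linarith

theorem stmt6 (γ : ℝ) (hγ : γ ∈ Set.Ioo (1 : ℝ) 2) :
    ∀ k : ℕ, ∑ j ∈ Finset.range (k + 2), grunwald γ j < 0 := by
  intro k
  have hs : 0 < γ := one_pos.trans hγ.1
  have hg := grunwald_add_two_pos hγ k
  refine neg_of_mul_neg_right ?_ hs.le
  rw [mul_sum_grunwald γ (k + 1), neg_lt_zero]
  positivity
end

section
/- For β ∈ (0,1) and m ≥ 2, the lower-triangular Toeplitz matrix G_β is strictly diagonally dominant by rows with nonpositive off-diagonal entries: every diagonal entry equals 1, every off-diagonal entry is ≤ 0, and for each row i one has ∑_{j ≠ i} |(G_β)_{i,j}| < 1 = (G_β)_{i,i}. -/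
/-- The `(m-1)×(m-1)` lower-triangular Toeplitz matrix `G_β` with entries
`(G_β)_{i,j} = g_{i-j}^{(β)}` for `i ≥ j` and `0` otherwise (0-based indices). -/
noncomputable def Gbeta (β : ℝ) (m : ℕ) : Matrix (Fin (m - 1)) (Fin (m - 1)) ℝ :=
  fun i j => if (j : ℕ) ≤ (i : ℕ) then grunwald β ((i : ℕ) - (j : ℕ)) else 0

theorem grunwald_zero (s : ℝ) : grunwald s 0 = 1 := by simp [grunwald]

theorem grunwald_succ_mul (s : ℝ) (j : ℕ) :
    (j + 1) * grunwald s (j + 1) = (j - s) * grunwald s j := by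
  have hj : (j.factorial : ℝ) ≠ 0 := by positivity
  have hj' : (j : ℝ) + 1 ≠ 0 := by positivity
  unfold grunwald
  rw [Finset.prod_range_succ, Nat.factorial_succ, pow_succ]
  push_cast
  field_simp
  ring

/-- The partial sums of the Grünwald coefficients are proportional to the next coefficient. -/
theorem neg_mul_sum_range_grunwald (s : ℝ) (n : ℕ) :
    -s * ∑ j ∈ Finset.range (n + 1), grunwald s j = (n + 1) * grunwald s (n + 1) := by
  induction n with
  | zero =>
    have h := grunwald_succ_mul s 0
    simp only [grunwald_zero, Nat.cast_zero, zero_add] at h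
    simp only [Nat.cast_zero, zero_add, Finset.sum_range_one, grunwald_zero]
    linarith
  | succ n ih =>
    have h := grunwald_succ_mul s (n + 1)
    rw [Finset.sum_range_succ, mul_add, ih]
    push_cast at h ⊢
    linarith

theorem grunwald_succ_neg {s : ℝ} (hs : s ∈ Set.Ioo (0 : ℝ) 1) (j : ℕ) :
    grunwald s (j + 1) < 0 := by
  induction j with
  | zero =>
    have h := grunwald_succ_mul s 0
    simp only [grunwald_zero, Nat.cast_zero] at h
    linarith [hs.1]
  | succ j ih =>
    have h := grunwald_succ_mul s (j + 1)
    have hpos : 0 < ((j + 1 : ℕ) : ℝ) - s := by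
      push_cast
      linarith [hs.2, j.cast_nonneg (α := ℝ)]
    have hneg := mul_neg_of_pos_of_neg hpos ih
    rw [← h] at hneg
    exact neg_of_mul_neg_right hneg (by positivity)

theorem sum_range_grunwald_pos {s : ℝ} (hs : s ∈ Set.Ioo (0 : ℝ) 1) (n : ℕ) :
    0 < ∑ j ∈ Finset.range (n + 1), grunwald s j := by
  have h := neg_mul_sum_range_grunwald s n
  have hneg : ((n : ℝ) + 1) * grunwald s (n + 1) < 0 :=
    mul_neg_of_pos_of_neg (by positivity) (grunwald_succ_neg hs n)
  refine pos_of_mul_pos_right (a := s) ?_ hs.1.le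
  linarith

theorem Gbeta_diag (β : ℝ) (m : ℕ) (i : Fin (m - 1)) : Gbeta β m i i = 1 := by
  simp [Gbeta, grunwald_zero]

theorem Gbeta_nonpos_of_ne {β : ℝ} (hβ : β ∈ Set.Ioo (0 : ℝ) 1) (m : ℕ) {i j : Fin (m - 1)}
    (hij : i ≠ j) : Gbeta β m i j ≤ 0 := by
  unfold Gbeta
  split_ifs with h
  · obtain ⟨k, hk⟩ : ∃ k, (i : ℕ) - j = k + 1 :=
      Nat.exists_eq_succ_of_ne_zero (by have := Fin.val_ne_of_ne hij; omega)
    rw [hk]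
    exact (grunwald_succ_neg hβ k).le
  · exact le_rfl

theorem sum_Gbeta_row (β : ℝ) (m : ℕ) (i : Fin (m - 1)) :
    ∑ j, Gbeta β m i j = ∑ k ∈ Finset.range ((i : ℕ) + 1), grunwald β k := by
  unfold Gbeta
  rw [Fin.sum_univ_eq_sum_range
    (fun j => if j ≤ (i : ℕ) then grunwald β ((i : ℕ) - j) else 0) (m - 1),
    ← Finset.sum_filter, ← Finset.sum_flip (fun k => grunwald β k)]
  refine Finset.sum_congr ?_ fun _ _ => rfl
  ext j
  simp only [Finset.mem_filter, Finset.mem_range]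
  omega

theorem stmt13 (m : ℕ) (hm : 2 ≤ m) (β : ℝ) (hβ : β ∈ Set.Ioo (0 : ℝ) 1) :
    (∀ i : Fin (m - 1), Gbeta β m i i = 1) ∧
    (∀ i j : Fin (m - 1), i ≠ j → Gbeta β m i j ≤ 0) ∧
    (∀ i : Fin (m - 1), ∑ j ∈ Finset.univ.erase i, |Gbeta β m i j| < 1) := by
  refine ⟨Gbeta_diag β m, fun i j => Gbeta_nonpos_of_ne hβ m, fun i => ?_⟩
  have habs : ∑ j ∈ Finset.univ.erase i, |Gbeta β m i j|
      = -∑ j ∈ Finset.univ.erase i, Gbeta β m i j := by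
    rw [← Finset.sum_neg_distrib]
    exact Finset.sum_congr rfl fun j hj =>
      abs_of_nonpos (Gbeta_nonpos_of_ne hβ m (Finset.ne_of_mem_erase hj).symm)
  have hsplit := Finset.add_sum_erase Finset.univ (Gbeta β m i) (Finset.mem_univ i)
  rw [sum_Gbeta_row, Gbeta_diag] at hsplit
  have hpos := sum_range_grunwald_pos hβ i
  linarith
end
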